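/- Let a, b, c be complex numbers such that neither (a+b+1)/2 nor 2c is a nonpositive integer and Re(2c−a−b) > −1. Then ₃F₂(a, b, c; (a+b+1)/2, 2c; 1) = [Γ(1/2) Γ(c+1/2) Γ((a+b+1)/2) Γ(c−(a+b−1)/2)] / [Γ((a+1)/2) Γ((b+1)/2) Γ(c−(a−1)/2) Γ(c−(b−1)/2)]. -/

import Mathlib

/-- Pochhammer symbol (rising factorial) `(c)_k = c (c+1) ⋯ (c+k-1)` for complex `c`. -/
noncomputable def poch (c : ℂ) (k : ℕ) : ℂ := ∏ l ∈ Finset.range k, (c + l)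

/-- Generalized hypergeometric series `ₚF_q(a; b; x) = Σ_k (a₁)_k⋯(a_p)_k / ((b₁)_k⋯(b_q)_k) · x^k/k!`. -/
noncomputable def pFq (a b : List ℂ) (x : ℂ) : ℂ :=
  ∑' k : ℕ, ((a.map (fun c => poch c k)).prod / (b.map (fun c => poch c k)).prod)
    * x ^ k / (Nat.factorial k)

/-- `c` is not a nonpositive integer, i.e. `c ≠ 0, -1, -2, …`. -/
def NotNonposInt (c : ℂ) : Prop := ∀ n : ℕ, c ≠ -(n : ℂ)

open Filter Topology Asymptotics

lemma poch_zero (z : ℂ) : poch z 0 = 1 := by simp [poch]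

lemma poch_succ (z : ℂ) (k : ℕ) : poch z (k + 1) = poch z k * (z + k) := by
  simp [poch, Finset.prod_range_succ]

lemma mul_poch_add_one (z : ℂ) (k : ℕ) : z * poch (z + 1) k = poch z k * (z + k) := by
  rw [← poch_succ, poch, poch, Finset.prod_range_succ']
  rw [mul_comm]
  congr 1
  · refine Finset.prod_congr rfl fun i _ => ?_
    push_cast
    ring
  · simp

lemma NotNonposInt.add_nat_ne_zero {z : ℂ} (hz : NotNonposInt z) (k : ℕ) : z + k ≠ 0 :=
  fun h => hz k (eq_neg_of_add_eq_zero_left h)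

lemma NotNonposInt.add_nat {z : ℂ} (hz : NotNonposInt z) (m : ℕ) : NotNonposInt (z + m) := by
  intro n h
  apply hz (n + m)
  push_cast
  linear_combination h

lemma NotNonposInt.ne_zero {z : ℂ} (hz : NotNonposInt z) : z ≠ 0 := by
  simpa using hz.add_nat_ne_zero 0

lemma NotNonposInt.of_re_pos {z : ℂ} (hz : 0 < z.re) : NotNonposInt z := by
  intro n h
  rw [h] at hz
  simp only [Complex.neg_re, Complex.natCast_re] at hz
  linarith [(Nat.cast_nonneg n : (0 : ℝ) ≤ n)]

lemma NotNonposInt.poch_ne_zero {z : ℂ} (hz : NotNonposInt z) (k : ℕ) : poch z k ≠ 0 :=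
  Finset.prod_ne_zero_iff.mpr fun l _ => hz.add_nat_ne_zero l

lemma NotNonposInt.Gamma_ne_zero {z : ℂ} (hz : NotNonposInt z) : Complex.Gamma z ≠ 0 :=
  Complex.Gamma_ne_zero hz

lemma tendsto_poch_div (z : ℂ) :
    Tendsto (fun n : ℕ => poch z (n + 1) / ((n : ℂ) ^ z * n.factorial)) atTop
      (𝓝 (Complex.Gamma z)⁻¹) := by
  by_cases hz : Complex.Gamma z = 0
  · obtain ⟨m, hm⟩ := (Complex.Gamma_eq_zero_iff z).mp hz
    rw [hz, inv_zero]
    refine tendsto_const_nhds.congr' ?_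
    filter_upwards [eventually_ge_atTop m] with n hn
    have : poch z (n + 1) = 0 :=
      Finset.prod_eq_zero (Finset.mem_range.mpr (Nat.lt_succ_of_le hn)) (by rw [hm]; ring)
    rw [this, zero_div]
  · refine ((Complex.GammaSeq_tendsto_Gamma z).inv₀ hz).congr fun n => ?_
    rw [Complex.GammaSeq, inv_div, poch]

/-- The `k`-th term of Watson's series. -/
noncomputable def watsonTerm (a b c : ℂ) (k : ℕ) : ℂ :=
  poch a k * poch b k * poch c k / (poch ((a + b + 1) / 2) k * poch (2 * c) k * k.factorial)

/-- The `k`-th term of the series in Gauss's second summation theorem. -/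
noncomputable def gaussTerm (a b : ℂ) (k : ℕ) : ℂ :=
  poch a k * poch b k / (poch ((a + b + 1) / 2) k * 2 ^ k * k.factorial)

lemma pFq_eq_tsum_watsonTerm (a b c : ℂ) :
    pFq [a, b, c] [(a + b + 1) / 2, 2 * c] 1 = ∑' k, watsonTerm a b c k := by
  refine tsum_congr fun k => ?_
  simp only [List.map_cons, List.map_nil, List.prod_cons, List.prod_nil, one_pow, mul_one,
    watsonTerm, div_div]
  ring

lemma watsonTerm_isBigO (a b c : ℂ) (h1 : NotNonposInt ((a + b + 1) / 2))
    (h2 : NotNonposInt (2 * c)) :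
    (fun n : ℕ => watsonTerm a b c (n + 1)) =O[atTop]
      fun n : ℕ => (n : ℝ) ^ (((a + b - 1) / 2 - c).re - 1) := by
  have hlim := (((tendsto_poch_div a).mul (tendsto_poch_div b)).mul (tendsto_poch_div c)).div
    ((tendsto_poch_div ((a + b + 1) / 2)).mul (tendsto_poch_div (2 * c)))
    (mul_ne_zero (inv_ne_zero h1.Gamma_ne_zero) (inv_ne_zero h2.Gamma_ne_zero))
  have hpow : (fun n : ℕ => (n : ℂ) ^ ((a + b - 1) / 2 - c) / (n + 1)) =O[atTop]
      fun n : ℕ => (n : ℝ) ^ (((a + b - 1) / 2 - c).re - 1) := by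
    refine IsBigO.of_bound 1 ?_
    filter_upwards [eventually_gt_atTop 0] with n hn
    have hn' : (0 : ℝ) < n := Nat.cast_pos.mpr hn
    rw [norm_div, Complex.norm_natCast_cpow_of_pos hn, one_mul, Real.norm_of_nonneg (by positivity),
      Real.rpow_sub_one hn'.ne']
    have : ‖(n : ℂ) + 1‖ = n + 1 := by
      exact_mod_cast Complex.norm_natCast (n + 1)
    rw [this]
    gcongr
    linarith
  have hmul := (hlim.isBigO_one ℝ).mul hpow
  simp only [one_mul] at hmul
  refine hmul.congr' ?_ EventuallyEq.rfl
  filter_upwards [eventually_gt_atTop 0] with n hn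
  have hn' : (n : ℂ) ≠ 0 := Nat.cast_ne_zero.mpr hn.ne'
  have hf : (n.factorial : ℂ) ≠ 0 := Nat.cast_ne_zero.mpr n.factorial_ne_zero
  have hn1 : (n : ℂ) + 1 ≠ 0 := Nat.cast_add_one_ne_zero n
  have e : (n : ℂ) ^ ((a + b - 1) / 2 - c) =
      (n : ℂ) ^ a * (n : ℂ) ^ b * (n : ℂ) ^ c / ((n : ℂ) ^ ((a + b + 1) / 2) * (n : ℂ) ^ (2 * c)) := by
    rw [← Complex.cpow_add _ _ hn', ← Complex.cpow_add _ _ hn', ← Complex.cpow_add _ _ hn',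
      ← Complex.cpow_sub _ _ hn']
    congr 1
    ring
  have p : ∀ w : ℂ, (n : ℂ) ^ w ≠ 0 := fun w => by simp [Complex.cpow_eq_zero_iff, hn']
  have q1 := h1.poch_ne_zero (n + 1)
  have q2 := h2.poch_ne_zero (n + 1)
  have pa := p a
  have pb := p b
  have pc := p c
  have ps := p ((a + b + 1) / 2)
  have pd := p (2 * c)
  simp only [Pi.div_apply]
  rw [e, watsonTerm, Nat.factorial_succ]
  push_cast
  generalize (n : ℂ) ^ ((a + b + 1) / 2) = S at *
  generalize (n : ℂ) ^ (2 * c) = D at *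
  generalize poch ((a + b + 1) / 2) (n + 1) = S' at *
  generalize poch (2 * c) (n + 1) = D' at *
  field_simp

lemma re_half_sub (a b c : ℂ) :
    ((a + b - 1) / 2 - c).re = (-1 - (2 * c - a - b).re) / 2 := by
  rw [show (a + b - 1) / 2 - c = ((-1 : ℝ) - (2 * c - a - b)) / (2 : ℝ) by push_cast; ring,
    Complex.div_ofReal_re, Complex.sub_re, Complex.ofReal_re]

lemma summable_watsonTerm (a b c : ℂ) (h1 : NotNonposInt ((a + b + 1) / 2))
    (h2 : NotNonposInt (2 * c)) (h3 : -1 < (2 * c - a - b).re) :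
    Summable (watsonTerm a b c) := by
  rw [← summable_nat_add_iff 1]
  refine summable_of_isBigO_nat (Real.summable_nat_rpow.mpr ?_) (watsonTerm_isBigO a b c h1 h2)
  linarith [re_half_sub a b c]

lemma tendsto_mul_watsonTerm (a b c : ℂ) (h1 : NotNonposInt ((a + b + 1) / 2))
    (h2 : NotNonposInt (2 * c)) (h3 : -1 < (2 * c - a - b).re) :
    Tendsto (fun k : ℕ => (k : ℂ) * watsonTerm a b c k) atTop (𝓝 0) := by
  rw [← tendsto_add_atTop_iff_nat 1]
  have hlin : (fun n : ℕ => ((n + 1 : ℕ) : ℂ)) =O[atTop] fun n : ℕ => (n : ℝ) := by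
    refine IsBigO.of_bound 2 ?_
    filter_upwards [eventually_gt_atTop 0] with n hn
    have hn' : (1 : ℝ) ≤ n := Nat.one_le_cast.mpr hn
    rw [Complex.norm_natCast, Real.norm_natCast]
    push_cast
    linarith
  refine (hlin.mul (watsonTerm_isBigO a b c h1 h2)).trans_tendsto ?_
  have h0 : Tendsto (fun n : ℕ => (n : ℝ) ^ (-((1 + (2 * c - a - b).re) / 2))) atTop (𝓝 0) :=
    (tendsto_rpow_neg_atTop (by linarith)).comp tendsto_natCast_atTop_atTop
  refine h0.congr' ?_
  filter_upwards [eventually_gt_atTop 0] with n hn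
  have hn' : (0 : ℝ) < n := Nat.cast_pos.mpr hn
  rw [Real.rpow_sub_one hn'.ne', mul_div_cancel₀ _ hn'.ne', re_half_sub]
  congr 1
  ring

lemma tsum_eq_zero_of_telescoping {u V : ℕ → ℂ} (hu : Summable u)
    (h : ∀ k, u k = V (k + 1) - V k) (h0 : V 0 = 0) (hV : Tendsto V atTop (𝓝 0)) :
    ∑' k, u k = 0 := by
  refine tendsto_nhds_unique hu.hasSum.tendsto_sum_nat (hV.congr fun n => ?_)
  rw [Finset.sum_congr rfl fun k _ => h k, Finset.sum_range_sub, h0, sub_zero]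

lemma watsonTerm_succ (a b c : ℂ) (k : ℕ) :
    watsonTerm a b c (k + 1) = watsonTerm a b c k *
      ((a + k) * (b + k) * (c + k) / (((a + b + 1) / 2 + k) * (2 * c + k) * (k + 1))) := by
  rw [watsonTerm, watsonTerm, div_mul_div_comm]
  simp only [poch_succ, Nat.factorial_succ]
  push_cast
  congr 1 <;> ring

lemma watsonTerm_add_one (a b c : ℂ) (h2 : NotNonposInt (2 * c)) (k : ℕ) :
    watsonTerm a b (c + 1) k = watsonTerm a b c k *
      (2 * (2 * c + 1) * (c + k) / ((2 * c + k) * (2 * c + k + 1))) := by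
  have hc : c ≠ 0 := fun h => h2.ne_zero (by rw [h, mul_zero])
  have hc1 : 2 * c + 1 ≠ 0 := by simpa using h2.add_nat_ne_zero 1
  have hk := h2.add_nat_ne_zero k
  have hk1 : 2 * c + k + 1 ≠ 0 := by
    have := h2.add_nat_ne_zero (k + 1)
    push_cast at this
    rwa [← add_assoc] at this
  have e1 : poch (c + 1) k = poch c k * (c + k) / c := by
    rw [← mul_poch_add_one, mul_div_cancel_left₀ _ hc]
  have e2 : poch (2 * (c + 1)) k =
      poch (2 * c) k * ((2 * c + k) * (2 * c + k + 1)) / (2 * c * (2 * c + 1)) := by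
    rw [eq_div_iff (mul_ne_zero h2.ne_zero hc1), show 2 * (c + 1) = 2 * c + 1 + 1 by ring]
    linear_combination (2 * c) * mul_poch_add_one (2 * c + 1) k +
      (2 * c + k + 1) * mul_poch_add_one (2 * c) k
  rw [watsonTerm, watsonTerm, e1, e2]
  field_simp

lemma tsum_watsonTerm_add_one (a b c : ℂ) (h1 : NotNonposInt ((a + b + 1) / 2))
    (h2 : NotNonposInt (2 * c)) (h3 : -1 < (2 * c - a - b).re) :
    (c + 1 / 2) * (c - (a + b - 1) / 2) * ∑' k, watsonTerm a b c k =
      (c - (a - 1) / 2) * (c - (b - 1) / 2) * ∑' k, watsonTerm a b (c + 1) k := by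
  have h2' : NotNonposInt (2 * (c + 1)) := by
    have := h2.add_nat 2
    rwa [show 2 * c + (2 : ℕ) = 2 * (c + 1) by push_cast; ring] at this
  have h3' : -1 < (2 * (c + 1) - a - b).re := by
    rw [show 2 * (c + 1) - a - b = (2 * c - a - b) + (2 : ℝ) by push_cast; ring, Complex.add_re,
      Complex.ofReal_re]
    linarith
  have s1 := (summable_watsonTerm a b c h1 h2 h3).mul_left ((2 * c + 1) * (2 * c + 1 - a - b))
  have s2 := (summable_watsonTerm a b (c + 1) h1 h2' h3').mul_left
    ((2 * c + 1 - a) * (2 * c + 1 - b))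
  have key := tsum_eq_zero_of_telescoping (s1.sub s2)
    (V := fun k => -2 * (2 * c + 1) * (((a + b + 1) / 2 + k - 1) / (2 * c + k)) *
      (k * watsonTerm a b c k)) ?_ (by simp) ?_
  · rw [s1.tsum_sub s2, tsum_mul_left, tsum_mul_left] at key
    linear_combination key / 4
  · intro k
    have hs := h1.add_nat_ne_zero k
    have hk := h2.add_nat_ne_zero k
    have hk1 : 2 * c + (k + 1) ≠ 0 := by
      have := h2.add_nat_ne_zero (k + 1)
      push_cast at this
      exact this
    have hk2 : (k : ℂ) + 1 ≠ 0 := Nat.cast_add_one_ne_zero k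
    rw [watsonTerm_add_one a b c h2, watsonTerm_succ]
    have hk1' : 2 * c + k + 1 ≠ 0 := by rwa [add_assoc]
    have hs' : a + b + 1 + 2 * k ≠ 0 := by
      intro h
      apply hs
      linear_combination h / 2
    push_cast
    rw [show (a + b + 1) / 2 + (k : ℂ) = (a + b + 1 + 2 * k) / 2 by ring, ← add_assoc,
      show (a + b + 1) / 2 + (k : ℂ) + 1 - 1 = (a + b + 1 + 2 * k) / 2 by ring]
    field_simp
    ring
  · have hr : Tendsto (fun k : ℕ => ((a + b + 1) / 2 + k - 1) / (2 * c + k)) atTop (𝓝 1) := by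
      have hinv : Tendsto (fun k : ℕ => ((k : ℂ))⁻¹) atTop (𝓝 0) :=
        tendsto_inv_atTop_nhds_zero_nat
      have := (((hinv.const_mul ((a + b + 1) / 2 - 1)).add_const 1)).div
        ((hinv.const_mul (2 * c)).add_const 1) (by simp)
      simp only [mul_zero, zero_add, div_one] at this
      refine this.congr' ?_
      filter_upwards [eventually_gt_atTop 0] with k hk
      have hk' : (k : ℂ) ≠ 0 := Nat.cast_ne_zero.mpr hk.ne'
      have h := h2.add_nat_ne_zero k
      simp only [Pi.div_apply]
      rw [← mul_div_mul_right _ _ hk']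
      congr 1 <;> field_simp
      ring
    simpa using (hr.const_mul (-2 * (2 * c + 1))).mul (tendsto_mul_watsonTerm a b c h1 h2 h3)

lemma norm_poch_div_le {X : ℝ} (hX : 0 < X) {c : ℂ} (hc : X ≤ c.re) (k : ℕ) :
    ‖poch c k / poch (2 * c) k‖ ≤ ‖poch X k / poch (2 * X) k‖ := by
  simp only [poch, ← Finset.prod_div_distrib, norm_prod]
  refine Finset.prod_le_prod (fun _ _ => norm_nonneg _) fun l _ => ?_
  have hl : (0 : ℝ) ≤ l := Nat.cast_nonneg l
  have e1 : ‖(X : ℂ) + l‖ = X + l := by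
    rw [show (X : ℂ) + l = ((X + l : ℝ) : ℂ) by push_cast; rfl, Complex.norm_real,
      Real.norm_of_nonneg (by positivity)]
  have e2 : ‖2 * (X : ℂ) + l‖ = 2 * X + l := by
    rw [show 2 * (X : ℂ) + l = ((2 * X + l : ℝ) : ℂ) by push_cast; rfl, Complex.norm_real,
      Real.norm_of_nonneg (by positivity)]
  have hpos : 0 < ‖2 * c + l‖ := by
    refine norm_pos_iff.mpr fun h => ?_
    have := congrArg Complex.re h
    simp at this
    linarith
  rw [norm_div, norm_div, e1, e2, div_le_div_iff₀ hpos (by positivity)]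
  refine le_of_sq_le_sq ?_ (by positivity)
  rw [mul_pow, mul_pow, Complex.sq_norm, Complex.sq_norm, Complex.normSq_apply,
    Complex.normSq_apply]
  simp only [Complex.add_re, Complex.add_im, Complex.natCast_re, Complex.natCast_im,
    Complex.mul_re, Complex.mul_im, Complex.re_ofNat, Complex.im_ofNat]
  have i1 : (c.re + l) * (2 * X + l) ≤ (X + l) * (2 * c.re + l) := by nlinarith
  have i2 : ((c.re + l) * (2 * X + l)) ^ 2 ≤ ((X + l) * (2 * c.re + l)) ^ 2 := by
    have : 0 ≤ c.re := by linarith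
    gcongr
  have i3 : 0 ≤ c.im ^ 2 * (4 * (X + l) ^ 2 - (2 * X + l) ^ 2) := by
    refine mul_nonneg (sq_nonneg _) ?_
    nlinarith [mul_nonneg hX.le hl]
  nlinarith

lemma norm_inv_two_pow_le {X : ℝ} (hX : 0 < X) (k : ℕ) :
    ‖((2 : ℂ) ^ k)⁻¹‖ ≤ ‖poch X k / poch (2 * X) k‖ := by
  have : ((2 : ℂ) ^ k)⁻¹ = ∏ l ∈ Finset.range k, (2 : ℂ)⁻¹ := by simp
  rw [this]
  simp only [poch, ← Finset.prod_div_distrib, norm_prod]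
  refine Finset.prod_le_prod (fun _ _ => norm_nonneg _) fun l _ => ?_
  have hl : (0 : ℝ) ≤ l := Nat.cast_nonneg l
  rw [show ((X : ℂ) + l) / (2 * X + l) = (((X + l) / (2 * X + l) : ℝ) : ℂ) by push_cast; rfl,
    Complex.norm_real, Real.norm_of_nonneg (by positivity), norm_inv, Complex.norm_ofNat,
    le_div_iff₀ (by positivity)]
  linarith

lemma watsonTerm_eq_mul (a b c : ℂ) (k : ℕ) :
    watsonTerm a b c k = poch a k * poch b k / (poch ((a + b + 1) / 2) k * k.factorial) *
      (poch c k / poch (2 * c) k) := by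
  rw [watsonTerm, div_mul_div_comm]
  congr 1
  ring

lemma gaussTerm_eq_mul (a b : ℂ) (k : ℕ) :
    gaussTerm a b k = poch a k * poch b k / (poch ((a + b + 1) / 2) k * k.factorial) *
      ((2 : ℂ) ^ k)⁻¹ := by
  rw [gaussTerm, ← div_eq_mul_inv, div_div]
  congr 1
  ring

lemma norm_watsonTerm_le (a b : ℂ) {X : ℝ} (hX : 0 < X) {c : ℂ} (hc : X ≤ c.re) (k : ℕ) :
    ‖watsonTerm a b c k‖ ≤ ‖watsonTerm a b X k‖ := by
  rw [watsonTerm_eq_mul, watsonTerm_eq_mul, norm_mul, norm_mul]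
  gcongr
  exact norm_poch_div_le hX hc k

lemma norm_gaussTerm_le (a b : ℂ) {X : ℝ} (hX : 0 < X) (k : ℕ) :
    ‖gaussTerm a b k‖ ≤ ‖watsonTerm a b X k‖ := by
  rw [watsonTerm_eq_mul, gaussTerm_eq_mul, norm_mul, norm_mul]
  gcongr
  exact norm_inv_two_pow_le hX k

lemma exists_dominating_parameter (a b : ℂ) :
    ∃ X : ℝ, 0 < X ∧ NotNonposInt (2 * (X : ℂ)) ∧ -1 < (2 * (X : ℂ) - a - b).re := by
  have re_two_mul : ∀ X : ℝ, (2 * (X : ℂ)).re = 2 * X := fun X => by simp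
  refine ⟨|a.re| + |b.re| + 1, by positivity, .of_re_pos ?_, ?_⟩
  · rw [re_two_mul]
    positivity
  · rw [Complex.sub_re, Complex.sub_re, re_two_mul]
    linarith [le_abs_self a.re, le_abs_self b.re, abs_nonneg a.re, abs_nonneg b.re]

lemma summable_gaussTerm (a b : ℂ) (h1 : NotNonposInt ((a + b + 1) / 2)) :
    Summable (gaussTerm a b) := by
  obtain ⟨X, hX, h2, h3⟩ := exists_dominating_parameter a b
  exact Summable.of_norm_bounded (summable_watsonTerm a b X h1 h2 h3).norm
    (norm_gaussTerm_le a b hX)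

lemma tendsto_mul_gaussTerm (a b : ℂ) (h1 : NotNonposInt ((a + b + 1) / 2)) :
    Tendsto (fun k : ℕ => (k : ℂ) * gaussTerm a b k) atTop (𝓝 0) := by
  obtain ⟨X, hX, h2, h3⟩ := exists_dominating_parameter a b
  refine squeeze_zero_norm (fun k => ?_) (tendsto_zero_iff_norm_tendsto_zero.mp
    (tendsto_mul_watsonTerm a b X h1 h2 h3))
  rw [norm_mul, norm_mul]
  gcongr
  exact norm_gaussTerm_le a b hX k

lemma tendsto_tsum_watsonTerm (a b c : ℂ) (h1 : NotNonposInt ((a + b + 1) / 2)) :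
    Tendsto (fun n : ℕ => ∑' k, watsonTerm a b (c + n) k) atTop (𝓝 (∑' k, gaussTerm a b k)) := by
  obtain ⟨X, hX, h2, h3⟩ := exists_dominating_parameter a b
  refine tendsto_tsum_of_dominated_convergence (summable_watsonTerm a b X h1 h2 h3).norm
    (fun k => ?_) ?_
  · simp only [watsonTerm_eq_mul, gaussTerm_eq_mul]
    refine Tendsto.const_mul _ ?_
    simp only [poch, ← Finset.prod_div_distrib]
    rw [← inv_pow, ← Finset.card_range k, ← Finset.prod_const, Finset.card_range]
    refine tendsto_finsetProd _ fun l _ => ?_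
    have hinv : Tendsto (fun n : ℕ => ((n : ℂ))⁻¹) atTop (𝓝 0) :=
      tendsto_inv_atTop_nhds_zero_nat
    have := ((hinv.const_mul (c + l)).add_const 1).div
      ((hinv.const_mul (2 * c + l)).add_const 2) (by simp)
    simp only [mul_zero, zero_add, one_div] at this
    refine this.congr' ?_
    filter_upwards [eventually_gt_atTop 0] with n hn
    have hn' : (n : ℂ) ≠ 0 := Nat.cast_ne_zero.mpr hn.ne'
    simp only [Pi.div_apply]
    rw [← mul_div_mul_right _ _ hn']
    congr 1 <;> field_simp <;> ring
  · filter_upwards [eventually_ge_atTop ⌈X - c.re⌉₊] with n hn k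
    refine norm_watsonTerm_le a b hX ?_ k
    rw [Complex.add_re, Complex.natCast_re]
    linarith [Nat.ceil_le.mp hn]

lemma poch_mul_tsum_watsonTerm (a b c : ℂ) (h1 : NotNonposInt ((a + b + 1) / 2))
    (h2 : NotNonposInt (2 * c)) (h3 : -1 < (2 * c - a - b).re) (n : ℕ) :
    poch (c + 1 / 2) n * poch (c - (a + b - 1) / 2) n * ∑' k, watsonTerm a b c k =
      poch (c - (a - 1) / 2) n * poch (c - (b - 1) / 2) n *
        ∑' k, watsonTerm a b (c + n) k := by
  induction n with
  | zero => simp [poch_zero]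
  | succ n ih =>
    have h2' : NotNonposInt (2 * (c + n)) := by
      have := h2.add_nat (2 * n)
      rwa [show 2 * c + (2 * n : ℕ) = 2 * (c + n) by push_cast; ring] at this
    have h3' : -1 < (2 * (c + n) - a - b).re := by
      rw [show 2 * (c + n) - a - b = (2 * c - a - b) + ((2 * n : ℕ) : ℂ) by push_cast; ring,
        Complex.add_re, Complex.natCast_re]
      linarith [(Nat.cast_nonneg (2 * n) : (0 : ℝ) ≤ (2 * n : ℕ))]
    have step := tsum_watsonTerm_add_one a b (c + n) h1 h2' h3'
    simp only [poch_succ]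
    push_cast
    rw [← add_assoc]
    linear_combination (c + 1 / 2 + n) * (c - (a + b - 1) / 2 + n) * ih +
      poch (c - (a - 1) / 2) n * poch (c - (b - 1) / 2) n * step

lemma tsum_watsonTerm_eq_mul_tsum_gaussTerm (a b c : ℂ) (h1 : NotNonposInt ((a + b + 1) / 2))
    (h2 : NotNonposInt (2 * c)) (h3 : -1 < (2 * c - a - b).re) :
    (Complex.Gamma (c + 1 / 2))⁻¹ * (Complex.Gamma (c - (a + b - 1) / 2))⁻¹ *
        ∑' k, watsonTerm a b c k =
      (Complex.Gamma (c - (a - 1) / 2))⁻¹ * (Complex.Gamma (c - (b - 1) / 2))⁻¹ *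
        ∑' k, gaussTerm a b k := by
  have l1 := ((tendsto_poch_div (c + 1 / 2)).mul
    (tendsto_poch_div (c - (a + b - 1) / 2))).mul_const (∑' k, watsonTerm a b c k)
  have l2 := ((tendsto_poch_div (c - (a - 1) / 2)).mul
    (tendsto_poch_div (c - (b - 1) / 2))).mul
      ((tendsto_tsum_watsonTerm a b c h1).comp (tendsto_add_atTop_nat 1))
  refine tendsto_nhds_unique l1 (l2.congr' ?_)
  filter_upwards [eventually_gt_atTop 0] with n hn
  have hn' : (n : ℂ) ≠ 0 := Nat.cast_ne_zero.mpr hn.ne'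
  have e : (n : ℂ) ^ (c - (a - 1) / 2) * (n : ℂ) ^ (c - (b - 1) / 2) =
      (n : ℂ) ^ (c + 1 / 2) * (n : ℂ) ^ (c - (a + b - 1) / 2) := by
    rw [← Complex.cpow_add _ _ hn', ← Complex.cpow_add _ _ hn']
    congr 1
    ring
  have key := poch_mul_tsum_watsonTerm a b c h1 h2 h3 (n + 1)
  simp only [Function.comp_apply]
  rw [div_mul_div_comm, div_mul_div_comm, mul_mul_mul_comm ((n : ℂ) ^ _), e,
    mul_mul_mul_comm ((n : ℂ) ^ (c + 1 / 2)), div_mul_eq_mul_div, div_mul_eq_mul_div, key]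

lemma sum_range_gauss_add_one (a b : ℂ) (h : NotNonposInt (a + b + 1)) (n : ℕ) :
    ∑ k ∈ Finset.range (n + 1), poch a k * poch b k / (poch (a + b + 1) k * k.factorial) =
      poch (a + 1) n * poch (b + 1) n / (poch (a + b + 1) n * n.factorial) := by
  induction n with
  | zero => simp [poch_zero]
  | succ n ih =>
    have hf : (n.factorial : ℂ) ≠ 0 := Nat.cast_ne_zero.mpr n.factorial_ne_zero
    have hn1 : (n : ℂ) + 1 ≠ 0 := Nat.cast_add_one_ne_zero n
    have hp := h.poch_ne_zero n
    have hk := h.add_nat_ne_zero n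
    rw [Finset.sum_range_succ, ih]
    have ea := mul_poch_add_one a n
    have eb := mul_poch_add_one b n
    rw [poch_succ a, poch_succ b, ← ea, ← eb, poch_succ, poch_succ, poch_succ,
      Nat.factorial_succ]
    push_cast
    generalize poch (a + b + 1) n = P at *
    field_simp
    ring

/-- Gauss's summation theorem for `₂F₁(a, b; a + b + 1; 1)`. -/
lemma tsum_watsonTerm_half_add_one (a b : ℂ) (h1 : NotNonposInt ((a + b + 1) / 2))
    (h : NotNonposInt (a + b + 1)) :
    ∑' k, watsonTerm a b ((a + b + 1) / 2) k =
      Complex.Gamma (a + b + 1) / (Complex.Gamma (a + 1) * Complex.Gamma (b + 1)) := by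
  have e2 : 2 * ((a + b + 1) / 2) = a + b + 1 := by ring
  have hs := summable_watsonTerm a b ((a + b + 1) / 2) h1 (by rwa [e2])
    (by rw [e2, show a + b + 1 - a - b = 1 by ring]; norm_num)
  have l1 := hs.hasSum.tendsto_sum_nat.comp (tendsto_add_atTop_nat 2)
  refine tendsto_nhds_unique l1 ?_
  have l2 := ((tendsto_poch_div (a + 1)).mul (tendsto_poch_div (b + 1))).div
    (tendsto_poch_div (a + b + 1)) (inv_ne_zero h.Gamma_ne_zero)
  have l3 := l2.mul (tendsto_natCast_div_add_atTop (1 : ℂ))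
  have e3 : (Complex.Gamma (a + 1))⁻¹ * (Complex.Gamma (b + 1))⁻¹ /
      (Complex.Gamma (a + b + 1))⁻¹ * 1 =
      Complex.Gamma (a + b + 1) / (Complex.Gamma (a + 1) * Complex.Gamma (b + 1)) := by
    rw [mul_one, div_inv_eq_mul, ← mul_inv, mul_comm, div_eq_mul_inv]
  rw [e3] at l3
  refine l3.congr' ?_
  filter_upwards [eventually_gt_atTop 0] with n hn
  have hterm : ∀ k, watsonTerm a b ((a + b + 1) / 2) k =
      poch a k * poch b k / (poch (a + b + 1) k * k.factorial) := fun k => by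
    rw [watsonTerm, e2, mul_comm _ (poch ((a + b + 1) / 2) k), mul_assoc (poch ((a + b + 1) / 2) k),
      mul_div_mul_left _ _ (h1.poch_ne_zero k)]
  simp only [Function.comp_apply, Pi.div_apply, hterm]
  rw [sum_range_gauss_add_one a b h (n + 1), Nat.factorial_succ]
  have hn' : (n : ℂ) ≠ 0 := Nat.cast_ne_zero.mpr hn.ne'
  have hf : (n.factorial : ℂ) ≠ 0 := Nat.cast_ne_zero.mpr n.factorial_ne_zero
  have hn1 : (n : ℂ) + 1 ≠ 0 := Nat.cast_add_one_ne_zero n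
  have e : (n : ℂ) ^ (a + 1) * (n : ℂ) ^ (b + 1) = (n : ℂ) ^ (a + b + 1) * n := by
    rw [← Complex.cpow_add _ _ hn', show a + 1 + (b + 1) = a + b + 1 + 1 by ring,
      Complex.cpow_add _ _ hn', Complex.cpow_one]
  have p : (n : ℂ) ^ (a + b + 1) ≠ 0 := by simp [Complex.cpow_eq_zero_iff, hn']
  have q := h.poch_ne_zero (n + 1)
  rw [div_mul_div_comm (poch (a + 1) _), mul_mul_mul_comm ((n : ℂ) ^ _), e]
  push_cast
  generalize (n : ℂ) ^ (a + b + 1) = S at *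
  generalize poch (a + b + 1) (n + 1) = S' at *
  field_simp

/-- Gauss's second summation theorem, for parameters with positive real part. -/
lemma tsum_gaussTerm_of_re_pos (a b : ℂ) (ha : 0 < a.re) (hb : 0 < b.re) :
    ∑' k, gaussTerm a b k = Complex.Gamma (1 / 2) * Complex.Gamma ((a + b + 1) / 2) /
      (Complex.Gamma ((a + 1) / 2) * Complex.Gamma ((b + 1) / 2)) := by
  have hhalf : ∀ z : ℂ, 0 < z.re → NotNonposInt (z / 2) := fun z hz => by
    refine .of_re_pos ?_
    rw [Complex.div_ofNat_re]
    positivity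
  have hs : 0 < (a + b + 1).re := by
    simp only [Complex.add_re, Complex.one_re]
    positivity
  have h1 := hhalf _ hs
  have h := NotNonposInt.of_re_pos hs
  have e2 : 2 * ((a + b + 1) / 2) = a + b + 1 := by ring
  have key := tsum_watsonTerm_eq_mul_tsum_gaussTerm a b ((a + b + 1) / 2) h1 (by rwa [e2])
    (by rw [e2, show a + b + 1 - a - b = 1 by ring]; norm_num)
  rw [tsum_watsonTerm_half_add_one a b h1 h,
    show (a + b + 1) / 2 - (a + b - 1) / 2 = 1 by ring, Complex.Gamma_one,
    show (a + b + 1) / 2 - (a - 1) / 2 = (b + 1) / 2 + 1 / 2 by ring,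
    show (a + b + 1) / 2 - (b - 1) / 2 = (a + 1) / 2 + 1 / 2 by ring] at key
  have dup : ∀ z : ℂ, Complex.Gamma z * Complex.Gamma (z + 1 / 2) =
      Complex.Gamma (2 * z) * 2 ^ (1 - 2 * z) * Complex.Gamma (1 / 2) := fun z => by
    rw [Complex.Gamma_mul_Gamma_add_half, Complex.Gamma_one_half_eq, Real.sqrt_eq_rpow,
      Complex.ofReal_cpow Real.pi_pos.le]
    norm_num
  have da := dup ((a + 1) / 2)
  have db := dup ((b + 1) / 2)
  have ds := dup ((a + b + 1) / 2)
  rw [show 2 * ((a + 1) / 2) = a + 1 by ring, show 1 - (a + 1) = -a by ring] at da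
  rw [show 2 * ((b + 1) / 2) = b + 1 by ring, show 1 - (b + 1) = -b by ring] at db
  rw [e2, show 1 - (a + b + 1) = -a + -b by ring, Complex.cpow_add _ _ two_ne_zero] at ds
  have re1 : ∀ z : ℂ, 0 < z.re → 0 < (z + 1).re := fun z hz => by
    rw [Complex.add_re, Complex.one_re]
    linarith
  have n1 := (hhalf _ (re1 a ha)).Gamma_ne_zero
  have n2 := (hhalf _ (re1 b hb)).Gamma_ne_zero
  have n3 := (NotNonposInt.of_re_pos (re1 a ha)).Gamma_ne_zero
  have n4 := (NotNonposInt.of_re_pos (re1 b hb)).Gamma_ne_zero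
  have n5 : Complex.Gamma ((a + 1) / 2 + 1 / 2) ≠ 0 := by
    rw [show (a + 1) / 2 + 1 / 2 = (a + 1 + 1) / 2 by ring]
    exact (hhalf _ (re1 _ (re1 a ha))).Gamma_ne_zero
  have n6 : Complex.Gamma ((b + 1) / 2 + 1 / 2) ≠ 0 := by
    rw [show (b + 1) / 2 + 1 / 2 = (b + 1 + 1) / 2 by ring]
    exact (hhalf _ (re1 _ (re1 b hb))).Gamma_ne_zero
  have n7 : Complex.Gamma ((a + b + 1) / 2 + 1 / 2) ≠ 0 := by
    rw [show (a + b + 1) / 2 + 1 / 2 = (a + b + 1 + 1) / 2 by ring]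
    exact (hhalf _ (re1 _ hs)).Gamma_ne_zero
  have n8 : Complex.Gamma (1 / 2) ≠ 0 := (hhalf 1 (by norm_num)).Gamma_ne_zero
  have n9 : (2 : ℂ) ^ (-a) ≠ 0 := by simp [Complex.cpow_eq_zero_iff]
  have n10 : (2 : ℂ) ^ (-b) ≠ 0 := by simp [Complex.cpow_eq_zero_iff]
  generalize Complex.Gamma ((a + 1) / 2) = A at *
  generalize Complex.Gamma ((b + 1) / 2) = B at *
  generalize Complex.Gamma ((a + 1) / 2 + 1 / 2) = A' at *
  generalize Complex.Gamma ((b + 1) / 2 + 1 / 2) = B' at *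
  generalize Complex.Gamma ((a + b + 1) / 2 + 1 / 2) = S' at *
  generalize Complex.Gamma ((a + b + 1) / 2) = S at *
  generalize Complex.Gamma (a + b + 1) = U at *
  generalize Complex.Gamma (a + 1) = P at *
  generalize Complex.Gamma (b + 1) = Q at *
  generalize Complex.Gamma (1 / 2) = w at *
  generalize (2 : ℂ) ^ (-a) = x at *
  generalize (2 : ℂ) ^ (-b) = y at *
  have key' : ∑' k, gaussTerm a b k = U * A' * B' / (P * Q * S') := by
    field_simp at key ⊢
    linear_combination -key
  rw [key', div_eq_div_iff (by positivity) (by positivity)]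
  have : U * A' * B' * (A * B) * (x * y * w) = w * S * (P * Q * S') * (x * y * w) := by
    calc _ = U * (A * A') * (B * B') * (x * y * w) := by ring
      _ = (U * (x * y) * w) * (P * Q * w) * (x * y * w) := by rw [da, db]; ring
      _ = _ := by rw [← ds]; ring
  exact mul_right_cancel₀ (by positivity) this

lemma tsum_gaussTerm_add_two (a b : ℂ) (ha : a ≠ 0) (h1 : NotNonposInt ((a + b + 1) / 2)) :
    (a + b + 1) * ∑' k, gaussTerm a b k = (a + 1) * ∑' k, gaussTerm (a + 2) b k := by
  have es : (a + 2 + b + 1) / 2 = (a + b + 1) / 2 + 1 := by ring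
  have h1' : NotNonposInt ((a + 2 + b + 1) / 2) := by
    rw [es]
    exact_mod_cast h1.add_nat 1
  have s1 := (summable_gaussTerm a b h1).mul_left (a * (a + b + 1))
  have s2 := (summable_gaussTerm (a + 2) b h1').mul_left (a * (a + 1))
  have key := tsum_eq_zero_of_telescoping (s1.sub s2)
    (V := fun k => (a + b + 1) * (k * gaussTerm a b k)) ?_ (by simp) ?_
  · rw [s1.tsum_sub s2, tsum_mul_left, tsum_mul_left] at key
    apply mul_left_cancel₀ ha
    linear_combination key
  · intro k
    have hs0 := h1.ne_zero
    have hs := h1.add_nat_ne_zero k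
    have hp := h1.poch_ne_zero k
    have hf : (k.factorial : ℂ) ≠ 0 := Nat.cast_ne_zero.mpr k.factorial_ne_zero
    have hk2 : (k : ℂ) + 1 ≠ 0 := Nat.cast_add_one_ne_zero k
    have e1 : a * (a + 1) * poch (a + 2) k = poch a k * (a + k) * (a + 1 + k) := by
      rw [show a + 2 = a + 1 + 1 by ring]
      linear_combination a * mul_poch_add_one (a + 1) k + (a + 1 + k) * mul_poch_add_one a k
    have e2 : poch ((a + b + 1) / 2 + 1) k =
        poch ((a + b + 1) / 2) k * ((a + b + 1) / 2 + k) / ((a + b + 1) / 2) := by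
      rw [← mul_poch_add_one, mul_div_cancel_left₀ _ hs0]
    have e3 : a * (a + 1) * gaussTerm (a + 2) b k =
        poch a k * (a + k) * (a + 1 + k) * poch b k /
          (poch ((a + b + 1) / 2 + 1) k * 2 ^ k * k.factorial) := by
      rw [gaussTerm, es, ← e1]
      ring
    rw [e3, e2, gaussTerm, gaussTerm]
    simp only [poch_succ, Nat.factorial_succ, pow_succ]
    have e4 : a + b + 1 = 2 * ((a + b + 1) / 2) := by ring
    have hb : b = 2 * ((a + b + 1) / 2) - a - 1 := by ring
    generalize poch b k = B at *
    generalize (a + b + 1) / 2 = s at *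
    rw [e4, hb]
    push_cast
    generalize poch s k = P at *
    field_simp
    ring
  · simpa using (tendsto_mul_gaussTerm a b h1).const_mul (a + b + 1)

lemma gaussTerm_comm (a b : ℂ) : gaussTerm a b = gaussTerm b a := by
  funext k
  rw [gaussTerm, gaussTerm, mul_comm (poch a k), add_comm a b]

lemma tsum_gaussTerm_zero_left (b : ℂ) : ∑' k, gaussTerm 0 b k = 1 := by
  rw [tsum_eq_single 0]
  · simp [gaussTerm, poch_zero]
  · intro k hk
    have : poch 0 k = 0 :=
      Finset.prod_eq_zero (Finset.mem_range.mpr (Nat.pos_of_ne_zero hk)) (by simp)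
    rw [gaussTerm, this, zero_mul, zero_div]

/-- The closed form of the sum of `gaussTerm a b`. -/
noncomputable def gaussValue (a b : ℂ) : ℂ :=
  Complex.Gamma (1 / 2) * Complex.Gamma ((a + b + 1) / 2) /
    (Complex.Gamma ((a + 1) / 2) * Complex.Gamma ((b + 1) / 2))

lemma gaussValue_comm (a b : ℂ) : gaussValue a b = gaussValue b a := by
  rw [gaussValue, gaussValue, add_comm a b, mul_comm (Complex.Gamma ((a + 1) / 2))]

lemma NotNonposInt.half_add_two {a b : ℂ} (h1 : NotNonposInt ((a + b + 1) / 2)) :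
    NotNonposInt ((a + 2 + b + 1) / 2) := by
  rw [show (a + 2 + b + 1) / 2 = (a + b + 1) / 2 + (1 : ℕ) by push_cast; ring]
  exact h1.add_nat 1

lemma tsum_gaussTerm_of_add_two (a b : ℂ) (h1 : NotNonposInt ((a + b + 1) / 2))
    (h : ∑' k, gaussTerm (a + 2) b k = gaussValue (a + 2) b) :
    ∑' k, gaussTerm a b k = gaussValue a b := by
  by_cases ha : a = 0
  · subst ha
    rw [zero_add] at h1
    have n1 := h1.Gamma_ne_zero
    have n2 : Complex.Gamma (1 / 2) ≠ 0 := Complex.Gamma_ne_zero_of_re_pos (by norm_num)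
    rw [tsum_gaussTerm_zero_left, gaussValue, zero_add, zero_add, div_self (mul_ne_zero n2 n1)]
  · have key := tsum_gaussTerm_add_two a b ha h1
    have hs := h1.ne_zero
    have hs' : a + b + 1 ≠ 0 := fun h => hs (by rw [h, zero_div])
    rw [h, gaussValue, show (a + 2 + b + 1) / 2 = (a + b + 1) / 2 + 1 by ring,
      show (a + 2 + 1) / 2 = (a + 1) / 2 + 1 by ring, Complex.Gamma_add_one _ hs] at key
    apply mul_left_cancel₀ hs'
    rw [key, gaussValue]
    by_cases ha1 : a + 1 = 0
    · simp [ha1]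
    · rw [Complex.Gamma_add_one _ (div_ne_zero ha1 two_ne_zero)]
      generalize Complex.Gamma ((a + 1) / 2) = A
      field_simp

lemma tsum_gaussTerm_of_re_pos_right (a b : ℂ) (hb : 0 < b.re)
    (h1 : NotNonposInt ((a + b + 1) / 2)) : ∑' k, gaussTerm a b k = gaussValue a b := by
  obtain ⟨n, hn⟩ := exists_nat_gt (-a.re)
  have hn' : 0 < a.re + 2 * n := by linarith [(Nat.cast_nonneg n : (0 : ℝ) ≤ n)]
  clear hn
  induction n generalizing a with
  | zero => exact tsum_gaussTerm_of_re_pos a b (by simpa using hn') hb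
  | succ n ih =>
    refine tsum_gaussTerm_of_add_two a b h1 (ih (a + 2) h1.half_add_two ?_)
    rw [Complex.add_re, Complex.re_ofNat]
    push_cast at hn'
    linarith

/-- Gauss's second summation theorem. -/
lemma tsum_gaussTerm (a b : ℂ) (h1 : NotNonposInt ((a + b + 1) / 2)) :
    ∑' k, gaussTerm a b k = gaussValue a b := by
  obtain ⟨n, hn⟩ := exists_nat_gt (-b.re)
  have hn' : 0 < b.re + 2 * n := by linarith [(Nat.cast_nonneg n : (0 : ℝ) ≤ n)]
  clear hn
  induction n generalizing b with
  | zero => exact tsum_gaussTerm_of_re_pos_right a b (by simpa using hn') h1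
  | succ n ih =>
    rw [add_comm a b] at h1
    have h2 := h1.half_add_two
    rw [gaussTerm_comm, gaussValue_comm]
    refine tsum_gaussTerm_of_add_two b a h1 ?_
    rw [gaussTerm_comm, gaussValue_comm]
    refine ih (b + 2) (by rwa [add_comm a]) ?_
    rw [Complex.add_re, Complex.re_ofNat]
    push_cast at hn'
    linarith

theorem watson_summation (a b c : ℂ)
    (h1 : NotNonposInt ((a + b + 1)/2)) (h2 : NotNonposInt (2*c))
    (h3 : (2*c - a - b).re > -1) :
    pFq [a, b, c] [(a + b + 1)/2, 2*c] 1 =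
      Complex.Gamma (1/2) * Complex.Gamma (c + 1/2) * Complex.Gamma ((a + b + 1)/2)
          * Complex.Gamma (c - (a + b - 1)/2) /
        (Complex.Gamma ((a + 1)/2) * Complex.Gamma ((b + 1)/2)
          * Complex.Gamma (c - (a - 1)/2) * Complex.Gamma (c - (b - 1)/2)) := by
  rw [pFq_eq_tsum_watsonTerm]
  have key := tsum_watsonTerm_eq_mul_tsum_gaussTerm a b c h1 h2 h3
  rw [tsum_gaussTerm a b h1, gaussValue] at key
  have n1 : Complex.Gamma (c + 1 / 2) ≠ 0 := by
    refine NotNonposInt.Gamma_ne_zero fun n hn => h2 (2 * n + 1) ?_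
    push_cast
    linear_combination 2 * hn
  have n2 : Complex.Gamma (c - (a + b - 1) / 2) ≠ 0 := by
    refine (NotNonposInt.of_re_pos ?_).Gamma_ne_zero
    rw [show c - (a + b - 1) / 2 = ((2 * c - a - b) + (1 : ℝ)) / (2 : ℝ) by push_cast; ring,
      Complex.div_ofReal_re, Complex.add_re, Complex.ofReal_re]
    linarith
  rw [← mul_inv, inv_mul_eq_iff_eq_mul₀ (mul_ne_zero n1 n2)] at key
  rw [key]
  simp only [div_eq_mul_inv, mul_inv]
  ring
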